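/- arXiv:1204.2441 — 2 statements merged into one kernel-verified Lean document; each statement's English description precedes it below -/
import Mathlib

section
/- Let (W,S) be a Coxeter system with length function ℓ. Let s ∈ S and x, y ∈ W be such that ℓ(xs) > ℓ(x), ℓ(sy) > ℓ(y), and additionally ℓ(xy) = ℓ(x) + ℓ(y). Then ℓ(xsy) = ℓ(x) + ℓ(y) + 1. -/
namespace CoxeterSystem

open List

variable {B W : Type*} [Group W] {M : CoxeterMatrix B} (cs : CoxeterSystem M W)

open Classical in
/-- The action of a simple reflection on `W × ZMod 2`: conjugation on the first factor, with the
sign flipped exactly at the simple reflection itself. -/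
noncomputable def signedConj (i : B) : Function.End (W × ZMod 2) :=
  fun p ↦ (cs.simple i * p.1 * cs.simple i, p.2 + if p.1 = cs.simple i then 1 else 0)

open Classical in
theorem signedConj_mul_pow_apply (i j : B) (n : ℕ) (p : W × ZMod 2) :
    ((cs.signedConj i * cs.signedConj j) ^ n) p =
      ((cs.simple i * cs.simple j) ^ n * p.1 * ((cs.simple i * cs.simple j) ^ n)⁻¹,
        p.2 + ∑ k ∈ Finset.range (2 * n),
          if p.1 = cs.simple j * (cs.simple i * cs.simple j) ^ k then 1 else 0) := by
  induction n with
  | zero => simp; rfl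
  | succ n ih =>
    set q := cs.simple i * cs.simple j with hq
    have hconj (k : ℕ) : (q ^ k)⁻¹ * cs.simple j = cs.simple j * q ^ k := by
      rw [inv_mul_eq_iff_eq_mul]
      induction k with
      | zero => simp
      | succ k ihk =>
        calc cs.simple j = q * cs.simple j * q := by simp [hq, mul_assoc]
          _ = q * (q ^ k * (cs.simple j * q ^ k)) * q := by rw [← ihk]
          _ = q ^ (k + 1) * (cs.simple j * q ^ (k + 1)) := by
            nth_rw 1 [pow_succ' q k]
            simp only [pow_succ q k, mul_assoc]
    have hj : q ^ n * p.1 * (q ^ n)⁻¹ = cs.simple j ↔ p.1 = cs.simple j * q ^ (2 * n) := by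
      rw [mul_inv_eq_iff_eq_mul, ← eq_inv_mul_iff_mul_eq, ← mul_assoc, hconj, mul_assoc, ← pow_add,
        two_mul]
    have hi : cs.simple j * (q ^ n * p.1 * (q ^ n)⁻¹) * cs.simple j = cs.simple i ↔
        p.1 = cs.simple j * q ^ (2 * n + 1) := by
      have : cs.simple j * (q ^ n * p.1 * (q ^ n)⁻¹) * cs.simple j = cs.simple i ↔
          q ^ n * p.1 * (q ^ n)⁻¹ = cs.simple j * q := by
        rw [hq, ← mul_left_cancel_iff (a := cs.simple j), ← mul_right_cancel_iff (a := cs.simple j)]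
        simp [mul_assoc]
      rw [this, mul_inv_eq_iff_eq_mul, ← eq_inv_mul_iff_mul_eq, ← mul_assoc, ← mul_assoc, hconj,
        mul_assoc, mul_assoc, ← pow_succ', ← pow_add]
      ring_nf
    rw [pow_succ']
    change (cs.signedConj i) (cs.signedConj j (((cs.signedConj i * cs.signedConj j) ^ n) p)) = _
    rw [ih]
    simp only [signedConj, hj, hi, mul_add, mul_one, Finset.sum_range_succ]
    refine Prod.ext ?_ ?_
    · simp [pow_succ', hq, mul_assoc]
    · simp only [add_assoc]

theorem isLiftable_signedConj : M.IsLiftable cs.signedConj := by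
  classical
  intro i j
  funext p
  rw [signedConj_mul_pow_apply, two_mul, Finset.sum_range_add]
  simp only [pow_add, simple_mul_simple_pow, one_mul, inv_one, mul_one, CharTwo.add_self_eq_zero,
    add_zero]
  rfl

/-- The action of `W` on `W × ZMod 2` extending `signedConj`. -/
noncomputable def signedConjHom : W →* Function.End (W × ZMod 2) :=
  cs.lift ⟨cs.signedConj, cs.isLiftable_signedConj⟩

theorem signedConjHom_simple (i : B) : cs.signedConjHom (cs.simple i) = cs.signedConj i :=
  cs.lift_apply_simple _ i

open Classical in
theorem signedConjHom_wordProd (ω : List B) (p : W × ZMod 2) :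
    cs.signedConjHom (cs.wordProd ω) p =
      (cs.wordProd ω * p.1 * (cs.wordProd ω)⁻¹, p.2 + (cs.rightInvSeq ω).count p.1) := by
  induction ω with
  | nil => simp; rfl
  | cons i ω ih =>
    rw [wordProd_cons, map_mul, signedConjHom_simple]
    change cs.signedConj i (cs.signedConjHom (cs.wordProd ω) p) = _
    have h : cs.wordProd ω * p.1 * (cs.wordProd ω)⁻¹ = cs.simple i ↔
        (cs.wordProd ω)⁻¹ * cs.simple i * cs.wordProd ω = p.1 := by
      rw [mul_inv_eq_iff_eq_mul, ← eq_inv_mul_iff_mul_eq, ← mul_assoc, eq_comm]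
    rw [ih]
    simp only [signedConj, rightInvSeq, count_cons, h, beq_iff_eq]
    refine Prod.ext ?_ ?_
    · simp [mul_assoc]
    · simp [add_assoc]

/-- The parity of the number of occurrences of `t` in the right inversion sequence of any word
for `w`. -/
noncomputable def inversionParity (w t : W) : ZMod 2 := (cs.signedConjHom w (t, 0)).2

open Classical in
theorem inversionParity_wordProd (ω : List B) (t : W) :
    cs.inversionParity (cs.wordProd ω) t = (cs.rightInvSeq ω).count t := by
  simp [inversionParity, signedConjHom_wordProd]

theorem signedConjHom_apply (w : W) (p : W × ZMod 2) :
    cs.signedConjHom w p = (w * p.1 * w⁻¹, p.2 + cs.inversionParity w p.1) := by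
  classical
  obtain ⟨ω, rfl⟩ := cs.wordProd_surjective w
  rw [signedConjHom_wordProd, inversionParity_wordProd]

theorem inversionParity_mul (u v t : W) :
    cs.inversionParity (u * v) t =
      cs.inversionParity v t + cs.inversionParity u (v * t * v⁻¹) := by
  have h : cs.signedConjHom (u * v) (t, 0) = cs.signedConjHom u (cs.signedConjHom v (t, 0)) := by
    rw [map_mul]; rfl
  simpa [signedConjHom_apply] using congrArg Prod.snd h

theorem inversionParity_one (t : W) : cs.inversionParity 1 t = 0 := by
  classical
  simpa using cs.inversionParity_wordProd [] t

theorem inversionParity_simple_self (i : B) :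
    cs.inversionParity (cs.simple i) (cs.simple i) = 1 := by
  classical
  simpa using cs.inversionParity_wordProd [i] (cs.simple i)

theorem IsReflection.inversionParity_self {t : W} (ht : cs.IsReflection t) :
    cs.inversionParity t t = 1 := by
  obtain ⟨w, i, rfl⟩ := ht
  have h := cs.inversionParity_mul w w⁻¹ (w * cs.simple i * w⁻¹)
  have hw : w⁻¹ * (w * cs.simple i * w⁻¹) * w⁻¹⁻¹ = cs.simple i := by group
  rw [mul_inv_cancel, inversionParity_one, hw] at h
  rw [inversionParity_mul, hw, inversionParity_mul, inversionParity_simple_self]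
  simp only [inv_simple, simple_mul_simple_self, one_mul]
  linear_combination -h

/-- The strong exchange condition: every right inversion of `w` occurs in the right inversion
sequence of every word for `w`. -/
theorem IsRightInversion.mem_rightInvSeq {ω : List B} {t : W}
    (h : cs.IsRightInversion (cs.wordProd ω) t) : t ∈ cs.rightInvSeq ω := by
  classical
  obtain ⟨ht, hlt⟩ := h
  by_contra hmem
  have hpar : cs.inversionParity (cs.wordProd ω * t) t = 1 := by
    rw [inversionParity_mul, ht.inversionParity_self, mul_inv_cancel_right,
      inversionParity_wordProd, count_eq_zero_of_not_mem hmem]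
    simp
  obtain ⟨ω', hω', hw⟩ := cs.exists_isReduced (cs.wordProd ω * t)
  have hmem' : t ∈ cs.rightInvSeq ω' := by
    by_contra hn
    rw [hw, inversionParity_wordProd, count_eq_zero_of_not_mem hn] at hpar
    simp at hpar
  have hlt' := (cs.isRightInversion_of_mem_rightInvSeq hω' hmem').2
  rw [← hw, mul_assoc, ht.mul_self, mul_one] at hlt'
  exact lt_asymm hlt hlt'

theorem IsRightInversion.exists_eraseIdx {ω : List B} {t : W}
    (h : cs.IsRightInversion (cs.wordProd ω) t) :
    ∃ k < ω.length, cs.wordProd ω * t = cs.wordProd (ω.eraseIdx k) := by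
  obtain ⟨k, hk, rfl⟩ := List.mem_iff_getElem.mp (IsRightInversion.mem_rightInvSeq cs h)
  refine ⟨k, by simpa using hk, ?_⟩
  rw [← getD_eq_getElem _ 1 hk, wordProd_mul_getD_rightInvSeq]

theorem IsReduced.length_wordProd_eraseIdx_lt {ω : List B} (hω : cs.IsReduced ω) {k : ℕ}
    (hk : k < ω.length) : cs.length (cs.wordProd (ω.eraseIdx k)) < cs.length (cs.wordProd ω) := by
  have := cs.length_wordProd_le (ω.eraseIdx k)
  have := length_eraseIdx_add_one hk
  have := hω.eq
  omega

end CoxeterSystem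


/-- Let `(W,S)` be a Coxeter system with length function `ℓ`.
If `s ∈ S`, `x, y ∈ W` satisfy `ℓ(xs) > ℓ(x)`, `ℓ(sy) > ℓ(y)` and
`ℓ(xy) = ℓ(x) + ℓ(y)`, then `ℓ(xsy) = ℓ(x) + ℓ(y) + 1`. -/
theorem length_mul_simple_mul_eq_add {B W : Type*} [Group W] {M : CoxeterMatrix B}
    (cs : CoxeterSystem M W) (i : B) (x y : W)
    (hx : cs.length (x * cs.simple i) > cs.length x)
    (hy : cs.length (cs.simple i * y) > cs.length y)
    (hxy : cs.length (x * y) = cs.length x + cs.length y) :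
    cs.length (x * cs.simple i * y) = cs.length x + cs.length y + 1 := by
  have ht : cs.IsReflection (y⁻¹ * cs.simple i * y) := by
    simpa using (cs.isReflection_simple i).conj y⁻¹
  have hmul : x * y * (y⁻¹ * cs.simple i * y) = x * cs.simple i * y := by group
  have hne := ht.length_mul_left_ne (x * y)
  have hle := cs.length_mul_le (x * cs.simple i) y
  have hxs := cs.length_mul_simple x i
  rw [hmul] at hne
  suffices ¬ cs.length (x * cs.simple i * y) < cs.length (x * y) by omega
  intro hlt
  obtain ⟨α, hα, rfl⟩ := cs.exists_isReduced x
  obtain ⟨β, hβ, rfl⟩ := cs.exists_isReduced y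
  rw [← hmul, ← cs.wordProd_append] at hlt
  obtain ⟨k, hk, hk'⟩ := CoxeterSystem.IsRightInversion.exists_eraseIdx cs ⟨ht, hlt⟩
  rw [cs.wordProd_append, hmul] at hk'
  rcases lt_or_ge k α.length with h | h
  · rw [List.eraseIdx_append_of_lt_length h, cs.wordProd_append, mul_left_inj] at hk'
    have := CoxeterSystem.IsReduced.length_wordProd_eraseIdx_lt cs hα h
    rw [← hk'] at this
    omega
  · rw [List.eraseIdx_append_of_length_le h, cs.wordProd_append, mul_assoc, mul_right_inj] at hk'
    have := CoxeterSystem.IsReduced.length_wordProd_eraseIdx_lt cs hβ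
      (k := k - α.length) (by rw [List.length_append] at hk; omega)
    rw [← hk'] at this
    omega
end

section
/- Let (W,S) be a Coxeter system with S finite, with geometric realization σ : W → GL(E) and root system Φ = Φ⁺ ⊔ Φ⁻. Let s ∈ S and x, y ∈ W with ℓ(xs) > ℓ(x) and ℓ(sy) > ℓ(y). Then one has the disjoint decomposition Φ_{xsy} = (Φ_y \ (y⁻¹s).Φ_x⁻) ⊔ ((y⁻¹s).Φ_x \ Φ_y⁻) ⊔ {y⁻¹.e_s}, i.e. these three sets are pairwise disjoint and their union is Φ_{xsy}. -/
/-- The symmetric bilinear form on `E = B → ℝ` attached to a Coxeter matrix `M`: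
`(e_i, e_j) = -cos (π / m_{ij})`, interpreted as `-1` when `m_{ij} = 0` (infinite order). -/
noncomputable def geomForm {B : Type*} [Fintype B] (M : CoxeterMatrix B)
    (f g : B → ℝ) : ℝ :=
  ∑ i, ∑ j, f i * g j *
    (if M i j = 0 then (-1 : ℝ) else -Real.cos (Real.pi / (M i j)))

/-- The set of roots `Φ = {x.e_s : x ∈ W, s ∈ S}` of the geometric realization `σ`. -/
def rootSet {B W : Type*} [DecidableEq B] [Group W]
    (σ : W →* ((B → ℝ) ≃ₗ[ℝ] (B → ℝ))) : Set (B → ℝ) :=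
  {v | ∃ (w : W) (i : B), σ w (Pi.single i 1) = v}

/-- The set of positive roots `Φ⁺`: roots which are nonnegative linear combinations
of the basis vectors `e_s`. -/
def posRoots {B W : Type*} [DecidableEq B] [Group W]
    (σ : W →* ((B → ℝ) ≃ₗ[ℝ] (B → ℝ))) : Set (B → ℝ) :=
  {v ∈ rootSet σ | ∀ i, 0 ≤ v i}

/-- The set of negative roots `Φ⁻ = -Φ⁺`. -/
def negRoots {B W : Type*} [DecidableEq B] [Group W]
    (σ : W →* ((B → ℝ) ≃ₗ[ℝ] (B → ℝ))) : Set (B → ℝ) :=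
  {v | -v ∈ posRoots σ}

/-- The inversion set `Φ_x = {α ∈ Φ⁺ : x.α ∈ Φ⁻}`. -/
def invSet {B W : Type*} [DecidableEq B] [Group W]
    (σ : W →* ((B → ℝ) ≃ₗ[ℝ] (B → ℝ))) (x : W) : Set (B → ℝ) :=
  {α ∈ posRoots σ | σ x α ∈ negRoots σ}

/-- The set `Φ_x⁻ = -Φ_x`. -/
def minusInvSet {B W : Type*} [DecidableEq B] [Group W]
    (σ : W →* ((B → ℝ) ≃ₗ[ℝ] (B → ℝ))) (x : W) : Set (B → ℝ) :=
  {v | -v ∈ invSet σ x}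

section GeomForm

variable {B : Type*} [Fintype B] (M : CoxeterMatrix B)

theorem geomForm_add_left (f g h : B → ℝ) :
    geomForm M (f + g) h = geomForm M f h + geomForm M g h := by
  simp only [geomForm, Pi.add_apply, add_mul, Finset.sum_add_distrib]

theorem geomForm_smul_left (a : ℝ) (f g : B → ℝ) :
    geomForm M (a • f) g = a * geomForm M f g := by
  simp only [geomForm, Pi.smul_apply, smul_eq_mul, Finset.mul_sum, mul_assoc]

theorem geomForm_comm (f g : B → ℝ) : geomForm M f g = geomForm M g f := by
  unfold geomForm
  rw [Finset.sum_comm]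
  refine Finset.sum_congr rfl fun i _ => Finset.sum_congr rfl fun j _ => ?_
  rw [M.symmetric j i, mul_comm (f j)]

theorem geomForm_single_single [DecidableEq B] (i j : B) :
    geomForm M (Pi.single i 1) (Pi.single j 1) =
      if M i j = 0 then (-1 : ℝ) else -Real.cos (Real.pi / (M i j)) := by
  unfold geomForm
  rw [Finset.sum_eq_single i (fun k _ hk => by simp [hk]) (by simp),
    Finset.sum_eq_single j (fun k _ hk => by simp [hk]) (by simp)]
  simp

theorem geomForm_single_self [DecidableEq B] (i : B) :
    geomForm M (Pi.single i 1) (Pi.single i 1) = 1 := by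
  simp [geomForm_single_single]

theorem geomForm_reflection_self [DecidableEq B] (i : B) (f : B → ℝ) :
    geomForm M (f - (2 * geomForm M f (Pi.single i 1)) • (Pi.single i 1 : B → ℝ))
      (f - (2 * geomForm M f (Pi.single i 1)) • (Pi.single i 1 : B → ℝ)) =
      geomForm M f f := by
  set e : B → ℝ := Pi.single i 1
  have he : geomForm M e e = 1 := geomForm_single_self M i
  rw [sub_eq_add_neg, ← neg_smul]
  rw [geomForm_add_left, geomForm_smul_left, geomForm_comm M f, geomForm_comm M e,
    geomForm_add_left, geomForm_smul_left, geomForm_add_left, geomForm_smul_left,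
    geomForm_comm M e f, he]
  ring

/-- The coefficients occurring in the orbit of a simple root under a rank two parabolic subgroup
are nonnegative as long as the word is no longer than the order of the product. -/
theorem exists_dihedral_coeff [DecidableEq B] {s t : B} (hst : s ≠ t) :
    ∃ a : ℕ → ℝ, a 0 = 0 ∧ a 1 = 1 ∧
      (∀ k, a (k + 2) =
        -2 * geomForm M (Pi.single s 1) (Pi.single t 1) * a (k + 1) - a k) ∧
      ∀ k, (M s t ≠ 0 → k ≤ M s t) → 0 ≤ a k := by
  rw [geomForm_single_single]
  by_cases hM : M s t = 0
  · refine ⟨fun k => k, by simp, by simp, fun k => ?_, fun k _ => by positivity⟩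
    simp only [hM, if_true]
    push_cast
    ring
  · have h2 : (2 : ℝ) ≤ M s t := by
      have := M.off_diagonal s t hst
      exact_mod_cast (by omega : 2 ≤ M s t)
    simp only [hM, if_false]
    set θ : ℝ := Real.pi / M s t with hθ
    have hmθ : M s t * θ = Real.pi := by
      rw [hθ]; field_simp
    have hθ0 : 0 < θ := by positivity
    have hsin : 0 < Real.sin θ := by
      apply Real.sin_pos_of_pos_of_lt_pi hθ0
      nlinarith
    refine ⟨fun k => Real.sin (k * θ) / Real.sin θ, by simp, by simp [hsin.ne'],
      fun k => ?_, fun k hk => ?_⟩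
    · have h1 : ((k + 2 : ℕ) : ℝ) * θ = (k + 1 : ℕ) * θ + θ := by push_cast; ring
      have h3 : (k : ℝ) * θ = (k + 1 : ℕ) * θ - θ := by push_cast; ring
      simp only [h1, h3, Real.sin_add, Real.sin_sub]
      field_simp
      ring
    · refine div_nonneg (Real.sin_nonneg_of_nonneg_of_le_pi (by positivity) ?_) hsin.le
      have : (k : ℝ) ≤ M s t := by exact_mod_cast hk hM
      nlinarith

end GeomForm

section Roots

variable {B W : Type*} [Group W] {σ : W →* ((B → ℝ) ≃ₗ[ℝ] (B → ℝ))}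

theorem geomRealization_mul_apply (v w : W) (e : B → ℝ) : σ (v * w) e = σ v (σ w e) := by
  rw [map_mul, LinearEquiv.mul_apply]

theorem geomRealization_inv_apply_self (w : W) (e : B → ℝ) : σ w⁻¹ (σ w e) = e := by
  rw [← geomRealization_mul_apply, inv_mul_cancel, map_one, LinearEquiv.coe_one, id]

theorem geomRealization_self_apply_inv (w : W) (e : B → ℝ) : σ w (σ w⁻¹ e) = e := by
  rw [← geomRealization_mul_apply, mul_inv_cancel, map_one, LinearEquiv.coe_one, id]

variable [DecidableEq B]

theorem apply_mem_rootSet (w : W) {v : B → ℝ} (hv : v ∈ rootSet σ) : σ w v ∈ rootSet σ := by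
  obtain ⟨u, i, rfl⟩ := hv
  exact ⟨w * u, i, geomRealization_mul_apply w u _⟩

theorem single_mem_posRoots (σ : W →* ((B → ℝ) ≃ₗ[ℝ] (B → ℝ))) (i : B) :
    (Pi.single i 1 : B → ℝ) ∈ posRoots σ := by
  refine ⟨⟨1, i, by simp⟩, fun j => ?_⟩
  by_cases h : j = i <;> simp [h]

theorem neg_mem_posRoots_iff {v : B → ℝ} : -v ∈ posRoots σ ↔ v ∈ negRoots σ := Iff.rfl

theorem neg_mem_negRoots_iff {v : B → ℝ} : -v ∈ negRoots σ ↔ v ∈ posRoots σ := by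
  rw [← neg_mem_posRoots_iff, neg_neg]

theorem notMem_negRoots_of_mem_posRoots {v : B → ℝ} (hv : v ∈ posRoots σ) :
    v ∉ negRoots σ := by
  intro h
  have h0 : v = 0 := funext fun i => le_antisymm (by simpa using h.2 i) (hv.2 i)
  obtain ⟨⟨w, i, hw⟩, -⟩ := hv
  rw [h0, LinearEquiv.map_eq_zero_iff] at hw
  simpa using congrFun hw i

end Roots

section GeomRealization

variable {B W : Type*} [Fintype B] [DecidableEq B] [Group W] {M : CoxeterMatrix B}
  (cs : CoxeterSystem M W) {σ : W →* ((B → ℝ) ≃ₗ[ℝ] (B → ℝ))}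

theorem simple_apply_single_self (hσ : ∀ (i : B) (e : B → ℝ),
      σ (cs.simple i) e = e - (2 * geomForm M e (Pi.single i 1)) • (Pi.single i 1 : B → ℝ))
    (i : B) :
    σ (cs.simple i) (Pi.single i 1) = -(Pi.single i 1 : B → ℝ) := by
  rw [hσ, geomForm_single_self]
  module

theorem geomForm_apply_self (hσ : ∀ (i : B) (e : B → ℝ),
      σ (cs.simple i) e = e - (2 * geomForm M e (Pi.single i 1)) • (Pi.single i 1 : B → ℝ))
    (w : W) (f : B → ℝ) :
    geomForm M (σ w f) (σ w f) = geomForm M f f := by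
  induction w using cs.simple_induction_left with
  | one => simp
  | mul_simple_left w i ih =>
    rw [geomRealization_mul_apply, hσ, geomForm_reflection_self, ih]

theorem apply_alternatingWord_single (hσ : ∀ (i : B) (e : B → ℝ),
      σ (cs.simple i) e = e - (2 * geomForm M e (Pi.single i 1)) • (Pi.single i 1 : B → ℝ))
    {s t : B}
    {a : ℕ → ℝ} (h0 : a 0 = 0) (h1 : a 1 = 1)
    (ha : ∀ k, a (k + 2) =
      -2 * geomForm M (Pi.single s 1) (Pi.single t 1) * a (k + 1) - a k) (k : ℕ) :
    σ (cs.wordProd (CoxeterSystem.alternatingWord s t k)) (Pi.single s 1) =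
      a (k + 1) • (Pi.single (if Even k then s else t) 1 : B → ℝ) +
        a k • (Pi.single (if Even k then t else s) 1 : B → ℝ) := by
  induction k with
  | zero => simp [CoxeterSystem.alternatingWord, h0, h1]
  | succ k ih =>
    rw [CoxeterSystem.alternatingWord_succ', cs.wordProd_cons, geomRealization_mul_apply, ih,
      ha k]
    by_cases hk : Even k
    · simp only [hk, if_true, Nat.even_add_one, not_true_eq_false, if_false, map_add, map_smul]
      rw [simple_apply_single_self cs hσ, hσ]
      module
    · simp only [hk, if_false, Nat.even_add_one, not_false_eq_true, if_true, map_add, map_smul]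
      rw [simple_apply_single_self cs hσ, hσ, geomForm_comm M (Pi.single t 1)]
      module

/-- If `ℓ(ws) > ℓ(w)`, then `w.e_s` has nonnegative coefficients. -/
theorem apply_single_nonneg (hσ : ∀ (i : B) (e : B → ℝ),
      σ (cs.simple i) e = e - (2 * geomForm M e (Pi.single i 1)) • (Pi.single i 1 : B → ℝ))
    {w : W} {s : B} (hws : ¬cs.IsRightDescent w s) :
    ∀ j, 0 ≤ σ w (Pi.single s 1) j := by
  induction hn : cs.length w using Nat.strong_induction_on generalizing w s with
  | _ n ih =>
  subst hn
  rcases eq_or_ne w 1 with rfl | hw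
  · rw [map_one]
    exact (single_mem_posRoots σ s).2
  obtain ⟨t, ht⟩ := cs.exists_rightDescent_of_ne_one hw
  have hst : s ≠ t := by
    rintro rfl
    exact hws ht
  let p : ℕ → W := fun k => cs.wordProd (CoxeterSystem.alternatingWord s t k)
  have p_succ (k : ℕ) : p (k + 1) = cs.simple (if Even k then t else s) * p k := by
    simp only [p, CoxeterSystem.alternatingWord_succ', cs.wordProd_cons]
  have length_p (k : ℕ) : cs.length (p k) ≤ k := by
    simpa using cs.length_wordProd_le (CoxeterSystem.alternatingWord s t k)
  have length_le (k : ℕ) : cs.length w ≤ cs.length (w * (p k)⁻¹) + k := by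
    have := cs.length_mul_le (w * (p k)⁻¹) (p k)
    rw [inv_mul_cancel_right] at this
    exact this.trans (Nat.add_le_add_left (length_p k) _)
  have inv_p_succ (k : ℕ) :
      w * (p (k + 1))⁻¹ = w * (p k)⁻¹ * cs.simple (if Even k then t else s) := by
    rw [p_succ, mul_inv_rev, cs.inv_simple, mul_assoc]
  let P : ℕ → Prop := fun k => cs.length (w * (p k)⁻¹) + k ≤ cs.length w
  have P_one : P 1 := by
    have h := cs.isRightDescent_iff.1 ht
    have : p 1 = cs.simple t := by simp [p, CoxeterSystem.alternatingWord]
    simp only [P, this, cs.inv_simple]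
    exact h.le
  have P_of_succ (k : ℕ) (h : P (k + 1)) : P k := by
    have h' := cs.length_mul_simple (w * (p k)⁻¹) (if Even k then t else s)
    rw [← inv_p_succ] at h'
    simp only [P] at h ⊢
    omega
  have P_of_le {k m : ℕ} (hkm : m ≤ k) (h : P k) : P m := by
    induction k, hkm using Nat.le_induction with
    | base => exact h
    | succ k _ ih => exact ih (P_of_succ k h)
  have lt_of_P {k : ℕ} (hk : P k) (hM : M s t ≠ 0) : k < M s t := by
    by_contra! hle
    have hm := P_of_le hle hk
    obtain ⟨m, hm'⟩ := Nat.exists_eq_succ_of_ne_zero hM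
    have hp : p (M s t) = p m * cs.simple s := by
      have := cs.wordProd_braidWord_eq s t
      simp only [CoxeterSystem.braidWord] at this
      simp only [p]
      rw [this, M.symmetric t s, hm', CoxeterSystem.alternatingWord_succ, cs.wordProd_concat]
    have hws' : w * cs.simple s = w * (p (M s t))⁻¹ * p m := by
      rw [hp, mul_inv_rev, ← mul_assoc, inv_mul_cancel_right, cs.inv_simple]
    have h1 := cs.length_mul_le (w * (p (M s t))⁻¹) (p m)
    rw [← hws', cs.not_isRightDescent_iff.1 hws] at h1
    have h2 := length_p m
    simp only [P] at hm
    omega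
  classical
  have one_le : 1 ≤ cs.length w := by
    have : cs.length w ≠ 0 := by simpa using hw
    omega
  obtain ⟨k, hk, hk1, hk2⟩ : ∃ k, P (k + 1) ∧ ¬P (k + 2) ∧ k + 1 ≤ cs.length w := by
    have hP : P (Nat.findGreatest P (cs.length w)) := Nat.findGreatest_spec one_le P_one
    have h1 : 1 ≤ Nat.findGreatest P (cs.length w) := Nat.le_findGreatest one_le P_one
    obtain ⟨k, hk⟩ := Nat.exists_eq_add_of_le' h1
    rw [hk] at hP
    refine ⟨k, hP, fun h => ?_, by simp only [P] at hP; omega⟩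
    have : k + 2 ≤ cs.length w := by simp only [P] at h; omega
    have := Nat.le_findGreatest this h
    omega
  have hkl : cs.length (w * (p (k + 1))⁻¹) + (k + 1) ≤ cs.length w := hk
  have hkl1 : cs.length w < cs.length (w * (p (k + 1 + 1))⁻¹) + (k + 2) := not_le.1 hk1
  set v := w * (p (k + 1))⁻¹ with hv
  have v_lt : cs.length v < cs.length w := by omega
  have descent_last : ¬cs.IsRightDescent v (if Even k then t else s) := by
    intro h
    have h' := cs.isRightDescent_iff.1 h
    rw [hv, inv_p_succ, cs.simple_mul_simple_cancel_right, ← inv_p_succ, ← hv] at h'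
    have := length_le k
    omega
  have descent_next : ¬cs.IsRightDescent v (if Even k then s else t) := by
    intro h
    have h' := cs.isRightDescent_iff.1 h
    have hpar : (if Even (k + 1) then t else s) = if Even k then s else t := by
      by_cases hk : Even k <;> simp [hk, Nat.even_add_one]
    rw [hv, ← hpar, ← inv_p_succ, ← hv] at h'
    omega
  have nonneg_last := ih _ v_lt descent_last rfl
  have nonneg_next := ih _ v_lt descent_next rfl
  obtain ⟨a, h0, h1, ha, ha_nonneg⟩ := exists_dihedral_coeff M hst
  have key : σ w (Pi.single s 1) =
      a (k + 2) • σ v (Pi.single (if Even k then t else s) 1 : B → ℝ) +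
        a (k + 1) • σ v (Pi.single (if Even k then s else t) 1 : B → ℝ) := by
    have hw' : w = v * p (k + 1) := by rw [hv, inv_mul_cancel_right]
    have h := apply_alternatingWord_single cs hσ h0 h1 ha (k + 1)
    rw [hw', geomRealization_mul_apply, h, map_add, map_smul, map_smul]
    by_cases hk : Even k <;> simp [hk, Nat.even_add_one]
  intro j
  rw [key]
  have c1 := ha_nonneg (k + 1) fun hM => (lt_of_P hk hM).le
  have c2 := ha_nonneg (k + 2) fun hM => lt_of_P hk hM
  exact add_nonneg (mul_nonneg c2 (nonneg_last j)) (mul_nonneg c1 (nonneg_next j))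

theorem apply_single_mem_posRoots (hσ : ∀ (i : B) (e : B → ℝ),
      σ (cs.simple i) e = e - (2 * geomForm M e (Pi.single i 1)) • (Pi.single i 1 : B → ℝ))
    {w : W} {s : B} (hws : ¬cs.IsRightDescent w s) :
    σ w (Pi.single s 1) ∈ posRoots σ :=
  ⟨⟨w, s, rfl⟩, apply_single_nonneg cs hσ hws⟩

/-- Every root is positive or negative. -/
theorem mem_posRoots_or_mem_negRoots (hσ : ∀ (i : B) (e : B → ℝ),
      σ (cs.simple i) e = e - (2 * geomForm M e (Pi.single i 1)) • (Pi.single i 1 : B → ℝ))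
    {v : B → ℝ} (hv : v ∈ rootSet σ) :
    v ∈ posRoots σ ∨ v ∈ negRoots σ := by
  obtain ⟨w, s, rfl⟩ := hv
  by_cases h : cs.IsRightDescent w s
  · right
    rw [cs.isRightDescent_iff_not_isRightDescent_mul] at h
    have := apply_single_mem_posRoots cs hσ h
    rwa [geomRealization_mul_apply, simple_apply_single_self cs hσ, map_neg] at this
  · exact .inl (apply_single_mem_posRoots cs hσ h)

theorem geomForm_self_of_mem_rootSet (hσ : ∀ (i : B) (e : B → ℝ),
      σ (cs.simple i) e = e - (2 * geomForm M e (Pi.single i 1)) • (Pi.single i 1 : B → ℝ))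
    {v : B → ℝ} (hv : v ∈ rootSet σ) :
    geomForm M v v = 1 := by
  obtain ⟨w, i, rfl⟩ := hv
  rw [geomForm_apply_self cs hσ, geomForm_single_self]

/-- The simple reflection `s` permutes the positive roots other than `e_s`. -/
theorem simple_apply_mem_posRoots (hσ : ∀ (i : B) (e : B → ℝ),
      σ (cs.simple i) e = e - (2 * geomForm M e (Pi.single i 1)) • (Pi.single i 1 : B → ℝ))
    {v : B → ℝ} {s : B} (hv : v ∈ posRoots σ)
    (hvs : v ≠ Pi.single s 1) : σ (cs.simple s) v ∈ posRoots σ := by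
  refine (mem_posRoots_or_mem_negRoots cs hσ (apply_mem_rootSet _ hv.1)).resolve_right
    fun hneg => hvs ?_
  have hzero (j : B) (hj : j ≠ s) : v j = 0 := by
    have h := hneg.2 j
    rw [hσ] at h
    simp [hj] at h
    exact le_antisymm h (hv.2 j)
  have hvs : v = v s • (Pi.single s 1 : B → ℝ) := by
    ext j
    by_cases hj : j = s
    · subst hj
      simp
    · simp [hj, hzero j hj]
  have hnorm := geomForm_self_of_mem_rootSet cs hσ hv.1
  have hs := hv.2 s
  generalize v s = c at hvs hs
  subst hvs
  rw [geomForm_smul_left, geomForm_comm, geomForm_smul_left, geomForm_single_self] at hnorm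
  have : c = 1 := by nlinarith
  rw [this, one_smul]

end GeomRealization

/-- Let `s ∈ S` and `x, y ∈ W` with `ℓ(xs) > ℓ(x)` and
`ℓ(sy) > ℓ(y)`.  Then one has the disjoint decomposition
`Φ_{xsy} = (Φ_y \ (y⁻¹s).Φ_x⁻) ⊔ ((y⁻¹s).Φ_x \ Φ_y⁻) ⊔ {y⁻¹.e_s}`. -/
theorem invSet_mul_simple_mul_eq_union
    {B W : Type*} [Fintype B] [DecidableEq B] [Group W]
    {M : CoxeterMatrix B} (cs : CoxeterSystem M W)
    (σ : W →* ((B → ℝ) ≃ₗ[ℝ] (B → ℝ)))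
    (hσ : ∀ (i : B) (e : B → ℝ),
      σ (cs.simple i) e = e - (2 * geomForm M e (Pi.single i 1)) • (Pi.single i 1 : B → ℝ))
    (i : B) (x y : W)
    (hx : cs.length (x * cs.simple i) > cs.length x)
    (hy : cs.length (cs.simple i * y) > cs.length y) :
    invSet σ (x * cs.simple i * y) =
      (invSet σ y \ (σ (y⁻¹ * cs.simple i)) '' minusInvSet σ x) ∪
        ((σ (y⁻¹ * cs.simple i)) '' invSet σ x \ minusInvSet σ y) ∪
        {σ y⁻¹ (Pi.single i 1 : B → ℝ)} ∧
    Disjoint (invSet σ y \ (σ (y⁻¹ * cs.simple i)) '' minusInvSet σ x)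
      ((σ (y⁻¹ * cs.simple i)) '' invSet σ x \ minusInvSet σ y) ∧
    Disjoint (invSet σ y \ (σ (y⁻¹ * cs.simple i)) '' minusInvSet σ x)
      {σ y⁻¹ (Pi.single i 1 : B → ℝ)} ∧
    Disjoint ((σ (y⁻¹ * cs.simple i)) '' invSet σ x \ minusInvSet σ y)
      {σ y⁻¹ (Pi.single i 1 : B → ℝ)} := by
  set r : B → ℝ := Pi.single i 1 with hr
  have hxr : σ x r ∈ posRoots σ :=
    apply_single_mem_posRoots cs hσ fun h => lt_asymm h hx
  have hyr : σ y⁻¹ r ∈ posRoots σ := by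
    refine apply_single_mem_posRoots cs hσ fun h => ?_
    rw [cs.isRightDescent_inv_iff] at h
    exact lt_asymm h hy
  have hss (e : B → ℝ) : σ (cs.simple i) (σ (cs.simple i) e) = e := by
    rw [← geomRealization_mul_apply, cs.simple_mul_simple_self, map_one, LinearEquiv.coe_one, id]
  have mem_image (α : B → ℝ) (A : Set (B → ℝ)) :
      α ∈ σ (y⁻¹ * cs.simple i) '' A ↔ σ (cs.simple i) (σ y α) ∈ A := by
    constructor
    · rintro ⟨β, hβ, rfl⟩
      rwa [geomRealization_mul_apply, geomRealization_self_apply_inv, hss]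
    · intro h
      refine ⟨_, h, ?_⟩
      rw [geomRealization_mul_apply, hss, geomRealization_inv_apply_self]
  have eq_iff (α : B → ℝ) : α = σ y⁻¹ r ↔ σ y α = r := by
    constructor
    · rintro rfl
      rw [geomRealization_self_apply_inv]
    · intro h
      rw [← h, geomRealization_inv_apply_self]
  have not_neg {v : B → ℝ} := notMem_negRoots_of_mem_posRoots (σ := σ) (v := v)
  have or_neg {v : B → ℝ} := mem_posRoots_or_mem_negRoots cs hσ (v := v)
  have hr_pos : r ∈ posRoots σ := single_mem_posRoots σ i
  have hsr : σ (cs.simple i) r = -r := simple_apply_single_self cs hσ i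
  refine ⟨?_, ?_, ?_, ?_⟩
  · ext α
    simp only [Set.mem_union, Set.mem_sdiff, Set.mem_singleton_iff, mem_image, eq_iff]
    have hz : σ (x * cs.simple i * y) α = σ x (σ (cs.simple i) (σ y α)) := by
      rw [geomRealization_mul_apply, geomRealization_mul_apply]
    constructor
    · rintro ⟨hα, hzα⟩
      rw [hz] at hzα
      rcases or_neg (apply_mem_rootSet y hα.1) with hyα | hyα
      · by_cases hyr' : σ y α = r
        · exact .inr hyr'
        · refine .inl (.inr ⟨⟨simple_apply_mem_posRoots cs hσ hyα hyr', hzα⟩, ?_⟩)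
          exact fun h => not_neg hα h.1
      · refine .inl (.inl ⟨⟨hα, hyα⟩, fun h => ?_⟩)
        have h2 := h.2
        rw [map_neg, neg_mem_negRoots_iff] at h2
        exact not_neg h2 hzα
    · rintro ((⟨⟨hα, hyα⟩, hn⟩ | ⟨⟨hsyα, hxα⟩, hn⟩) | hα)
      · refine ⟨hα, ?_⟩
        rw [hz]
        have hne : -σ y α ≠ r := by
          intro h
          have : α = -σ y⁻¹ r := by
            rw [← h, map_neg, geomRealization_inv_apply_self, neg_neg]
          rw [this] at hα
          exact not_neg hyr hα
        have hpos := simple_apply_mem_posRoots cs hσ hyα hne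
        rw [map_neg] at hpos
        refine (or_neg (apply_mem_rootSet _ (apply_mem_rootSet _
          (apply_mem_rootSet _ hα.1)))).resolve_left fun h => hn ⟨hpos, ?_⟩
        rwa [map_neg, neg_mem_negRoots_iff]
      · have hroot : α ∈ rootSet σ := by
          have := apply_mem_rootSet y⁻¹ (apply_mem_rootSet (cs.simple i) hsyα.1)
          rwa [hss, geomRealization_inv_apply_self] at this
        refine ⟨(or_neg hroot).resolve_right fun hα => hn ⟨hα, ?_⟩, by rwa [hz]⟩
        have hne : σ (cs.simple i) (σ y α) ≠ r := by
          intro h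
          rw [h] at hxα
          exact not_neg hxr hxα
        have hpos := simple_apply_mem_posRoots cs hσ hsyα hne
        rw [hss] at hpos
        rwa [map_neg, neg_mem_negRoots_iff]
      · refine ⟨?_, ?_⟩
        · rwa [(eq_iff α).2 hα]
        · rwa [hz, hα, hsr, map_neg, neg_mem_negRoots_iff]
  · rw [Set.disjoint_left]
    rintro α ⟨⟨hα, hyα⟩, -⟩ ⟨h, -⟩
    rw [mem_image] at h
    have hne : -σ y α ≠ r := by
      intro hr'
      have : α = -σ y⁻¹ r := by
        rw [← hr', map_neg, geomRealization_inv_apply_self, neg_neg]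
      rw [this] at hα
      exact not_neg hyr hα
    have hpos := simple_apply_mem_posRoots cs hσ hyα hne
    rw [map_neg] at hpos
    exact not_neg h.1 hpos
  · rw [Set.disjoint_singleton_right]
    rintro ⟨⟨-, h⟩, -⟩
    rw [geomRealization_self_apply_inv] at h
    exact not_neg hr_pos h
  · rw [Set.disjoint_singleton_right]
    rintro ⟨h, -⟩
    rw [mem_image, geomRealization_self_apply_inv, hsr] at h
    exact not_neg hr_pos h.1
end
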